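/- Finite-time blow up for the sign-definite special case: There exist nonnegative, infinitely differentiable initial data ω₀, ρ₀ compactly supported in (0,1) (one may take ω₀ = 0 and ρ₀ with 0 ≤ ρ₀ ≤ 1 and ρ₀ ≡ 1 on [1/3, 2/3]) and a finite time T* ∈ (0,∞) such that no classical solution of the special model (with associated flow map) with initial data (ω₀, ρ₀) exists on the whole time interval [0,T*]. -/

import Mathlib

open MeasureTheory

/-- The Biot–Savart velocity of the special (sign-definite) model:
`u(x,t) = −x·∫_x^1 ω(y,t)/y dy`. -/
noncomputable def svel (ω : ℝ → ℝ → ℝ) (x t : ℝ) : ℝ :=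
  -(x * ∫ y in x..(1:ℝ), ω y t / y)

/-- A classical solution of the special model on `(0,1) × [0,T)`, with its flow map `Φ`. -/
structure IsClassicalSolutionSpecial (T : ℝ) (ω ρ Φ : ℝ → ℝ → ℝ) : Prop where
  Tpos : 0 < T
  omega_smooth : ContDiffOn ℝ 1 (fun p : ℝ × ℝ => ω p.1 p.2) (Set.Ioo 0 1 ×ˢ Set.Ico 0 T)
  rho_smooth : ContDiffOn ℝ 1 (fun p : ℝ × ℝ => ρ p.1 p.2) (Set.Ioo 0 1 ×ˢ Set.Ico 0 T)
  omega_nonneg : ∀ x t, 0 ≤ ω x t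
  rho_nonneg : ∀ x t, 0 ≤ ρ x t
  supp : ∀ t, 0 ≤ t → t < T → ∃ a b : ℝ, 0 < a ∧ a ≤ b ∧ b < 1 ∧
      ∀ x, x ∉ Set.Icc a b → ω x t = 0 ∧ ρ x t = 0
  omega_eq : ∀ x ∈ Set.Ioo (0:ℝ) 1, ∀ t, 0 ≤ t → t < T →
      derivWithin (fun s => ω x s) (Set.Ico 0 T) t
        + svel ω x t * deriv (fun y => ω y t) x = ρ x t / x
  rho_eq : ∀ x ∈ Set.Ioo (0:ℝ) 1, ∀ t, 0 ≤ t → t < T →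
      derivWithin (fun s => ρ x s) (Set.Ico 0 T) t
        + svel ω x t * deriv (fun y => ρ y t) x = 0
  flow_init : ∀ x ∈ Set.Ioo (0:ℝ) 1, Φ x 0 = x
  flow_deriv : ∀ x ∈ Set.Ioo (0:ℝ) 1, ∀ t, 0 ≤ t → t < T →
      HasDerivWithinAt (fun s => Φ x s) (svel ω (Φ x t) t) (Set.Ico 0 T) t
  flow_mono : ∀ t, 0 ≤ t → t < T → StrictMonoOn (fun x => Φ x t) (Set.Ioo 0 1)
  flow_bij : ∀ t, 0 ≤ t → t < T → Set.BijOn (fun x => Φ x t) (Set.Ioo 0 1) (Set.Ioo 0 1)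

open Set Filter Topology

/-- Comparison of integrals against `dy / y` under a map that is monotone and nonexpansive for
the logarithmic distance. -/
theorem integral_div_le_of_log_nonexpansive {c d : ℝ} (hc : 0 < c) (hcd : c ≤ d)
    {η h g : ℝ → ℝ} (hη_pos : ∀ y ∈ Icc c d, 0 < η y) (hη_mono : MonotoneOn η (Icc c d))
    (hη_log : ∀ y ∈ Icc c d, ∀ z ∈ Icc c d, y ≤ z →
      Real.log (η z) - Real.log (η y) ≤ Real.log z - Real.log y)
    (hh : ContinuousOn h (Ioi 0)) (hh_nonneg : ∀ x, 0 ≤ h x) (hg : ContinuousOn g (Ioi 0))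
    (hhg : ∀ y ∈ Icc c d, h (η y) ≤ g y) :
    ∫ x in η c..η d, h x / x ≤ ∫ y in c..d, g y / y := by
  have cont_div : ∀ {k : ℝ → ℝ}, ContinuousOn k (Ioi 0) →
      ContinuousOn (fun x => k x / x) (Ioi 0) := fun hk =>
    hk.div continuousOn_id fun x hx => (ne_of_gt hx)
  have integrable_div : ∀ {k : ℝ → ℝ}, ContinuousOn k (Ioi 0) → ∀ {p q : ℝ}, 0 < p → 0 < q →
      IntervalIntegrable (fun x => k x / x) volume p q := by
    intro k hk p q hp hq
    refine ((cont_div hk).mono fun x hx => ?_).intervalIntegrable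
    exact lt_of_lt_of_le (lt_min hp hq) hx.1
  have hcI : c ∈ Icc c d := left_mem_Icc.2 hcd
  have pos_of_mem : ∀ y ∈ Icc c d, 0 < y := fun y hy => hc.trans_le hy.1
  have hη_cont : ContinuousOn η (Icc c d) := by
    have hlog : ContinuousOn (fun y => Real.log (η y)) (Icc c d) := by
      intro y hy
      have hlogy : Tendsto (fun z => |Real.log z - Real.log y|) (𝓝[Icc c d] y) (𝓝 0) := by
        have : ContinuousAt (fun z => |Real.log z - Real.log y|) y :=
          ((Real.continuousAt_log (pos_of_mem y hy).ne').sub continuousAt_const).abs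
        simpa [ContinuousAt] using this.tendsto.mono_left
          (nhdsWithin_le_nhds (s := Icc c d))
      refine tendsto_iff_dist_tendsto_zero.2
        (squeeze_zero' (Eventually.of_forall fun _ => dist_nonneg) ?_ hlogy)
      filter_upwards [self_mem_nhdsWithin] with z hz
      rw [Real.dist_eq]
      rcases le_total y z with hyz | hzy
      · have h1 := hη_log y hy z hz hyz
        have h2 := Real.log_le_log (hη_pos y hy) (hη_mono hy hz hyz)
        rw [abs_of_nonneg (by linarith)]
        exact h1.trans (le_abs_self _)
      · have h1 := hη_log z hz y hy hzy
        have h2 := Real.log_le_log (hη_pos z hz) (hη_mono hz hy hzy)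
        rw [abs_of_nonpos (by linarith)]
        exact le_trans (by linarith) (neg_le_abs _)
    exact hlog.rexp.congr fun y hy => (Real.exp_log (hη_pos y hy)).symm
  set F : ℝ → ℝ := fun y => ∫ x in η c..y, h x / x with hF
  have hF_deriv : ∀ y, 0 < y → HasDerivAt F (h y / y) y := fun y hy =>
    intervalIntegral.integral_hasDerivAt_right (integrable_div hh (hη_pos c hcI) hy)
      ((cont_div hh).stronglyMeasurableAtFilter isOpen_Ioi y hy)
      ((cont_div hh).continuousAt (Ioi_mem_nhds hy))
  have hG_deriv : ∀ y, 0 < y → HasDerivAt (fun z => ∫ x in c..z, g x / x) (g y / y) y :=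
    fun y hy =>
    intervalIntegral.integral_hasDerivAt_right (integrable_div hg hc hy)
      ((cont_div hg).stronglyMeasurableAtFilter isOpen_Ioi y hy)
      ((cont_div hg).continuousAt (Ioi_mem_nhds hy))
  have key := image_le_of_liminf_slope_right_le_deriv_boundary (f := fun y => F (η y))
    (a := c) (b := d) (B := fun z => ∫ x in c..z, g x / x) (B' := fun y => g y / y)
    (fun y hy => (hF_deriv _ (hη_pos y hy)).continuousAt.comp_continuousWithinAt (hη_cont y hy))
    (by simp [hF])
    (fun y hy => (hG_deriv y (pos_of_mem y hy)).continuousAt.continuousWithinAt)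
    (fun y hy => (hG_deriv y (pos_of_mem y (Ico_subset_Icc_self hy))).hasDerivWithinAt)
    ?_
  · exact key (right_mem_Icc.2 hcd)
  intro y hy r hr
  have hyI := Ico_subset_Icc_self hy
  have hy0 := pos_of_mem y hyI
  obtain ⟨M, hM1, hM2⟩ := exists_between ((div_lt_iff₀ hy0).1 hr)
  have hM0 : 0 ≤ M := (hh_nonneg _).trans ((hhg y hyI).trans hM1.le)
  have hIcc : Icc c d ∈ 𝓝[>] y :=
    mem_of_superset (Ioc_mem_nhdsGT hy.2) fun z hz => ⟨hy.1.trans hz.1.le, hz.2⟩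
  have hslope : ∀ᶠ z in 𝓝[>] y, M * slope Real.log y z < r := by
    have h1 := (hasDerivAt_iff_tendsto_slope.1 (Real.hasDerivAt_log hy0.ne')).const_mul M
    have h2 := h1.mono_left (nhdsWithin_mono y (fun z (hz : y < z) => hz.ne'))
    refine h2.eventually_lt_const ?_
    rwa [← div_eq_mul_inv, div_lt_iff₀ hy0]
  have hsmall : ∀ᶠ x in 𝓝 (η y), h x < M :=
    (hh.continuousAt (Ioi_mem_nhds (hη_pos y hyI))).eventually_lt_const
      ((hhg y hyI).trans_lt hM1)
  obtain ⟨l, u, hlu, hsub⟩ := mem_nhds_iff_exists_Ioo_subset.1 hsmall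
  have hη_lt : ∀ᶠ z in 𝓝[>] y, η z < u := by
    have h1 := (hη_cont y hyI).eventually_lt_const hlu.2
    exact h1.filter_mono (nhdsWithin_le_iff.2 hIcc)
  refine Eventually.frequently ?_
  filter_upwards [hslope, hη_lt, hIcc, self_mem_nhdsWithin] with z hz1 hz2 hzI hyz
  have hyz : y < z := hyz
  have hle : η y ≤ η z := hη_mono hyI hzI hyz.le
  have hFle : F (η z) - F (η y) ≤ M * (Real.log z - Real.log y) := by
    have e1 : F (η z) - F (η y) = ∫ x in η y..η z, h x / x :=
      intervalIntegral.integral_interval_sub_left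
        (integrable_div hh (hη_pos c hcI) (hη_pos z hzI))
        (integrable_div hh (hη_pos c hcI) (hη_pos y hyI))
    have e2 : ∫ x in η y..η z, h x / x ≤ ∫ x in η y..η z, M / x := by
      refine intervalIntegral.integral_mono_on hle
        (integrable_div hh (hη_pos y hyI) (hη_pos z hzI))
        (integrable_div continuousOn_const (hη_pos y hyI) (hη_pos z hzI)) fun x hx => ?_
      have : h x < M := hsub ⟨hlu.1.trans_le hx.1, hx.2.trans_lt hz2⟩
      have hx0 : 0 < x := (hη_pos y hyI).trans_le hx.1
      gcongr
    have e3 : ∫ x in η y..η z, M / x = M * (Real.log (η z) - Real.log (η y)) := by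
      simp_rw [div_eq_mul_inv]
      rw [intervalIntegral.integral_const_mul,
        integral_inv_of_pos (hη_pos y hyI) (hη_pos z hzI),
        Real.log_div (hη_pos z hzI).ne' (hη_pos y hyI).ne']
    rw [e1]
    exact e2.trans (e3.le.trans
      (mul_le_mul_of_nonneg_left (hη_log y hyI z hzI hyz.le) hM0))
  refine lt_of_le_of_lt ?_ hz1
  rw [slope_def_field, slope_def_field, ← mul_div_assoc]
  have : 0 < z - y := sub_pos.2 hyz
  gcongr

/-- Differentiation of a `C¹` function along a curve in space-time. -/
theorem hasDerivWithinAt_along_curve {T : ℝ} {f : ℝ → ℝ → ℝ}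
    (hf : ContDiffOn ℝ 1 (fun p : ℝ × ℝ => f p.1 p.2) (Ioo 0 1 ×ˢ Ico 0 T))
    {X : ℝ → ℝ} {v t : ℝ} (hX_mem : ∀ s ∈ Ico 0 T, X s ∈ Ioo (0 : ℝ) 1) (ht : t ∈ Ico 0 T)
    (hX : HasDerivWithinAt X v (Ico 0 T) t) :
    HasDerivWithinAt (fun s => f (X s) s)
      (derivWithin (fun s => f (X t) s) (Ico 0 T) t + v * deriv (fun y => f y t) (X t))
      (Ico 0 T) t := by
  have hd := (hf.differentiableOn one_ne_zero (X t, t) ⟨hX_mem t ht, ht⟩).hasFDerivWithinAt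
  set D := fderivWithin ℝ (fun p : ℝ × ℝ => f p.1 p.2) (Ioo 0 1 ×ˢ Ico 0 T) (X t, t)
  have hcurve := hd.comp_hasDerivWithinAt (f := fun s => (X s, s)) t
    (hX.prodMk (hasDerivWithinAt_id t _))
    (fun s hs => ⟨hX_mem s hs, hs⟩)
  have htime := hd.comp_hasDerivWithinAt (f := fun s => (X t, s)) t
    ((hasDerivWithinAt_const t (Ico 0 T) (X t)).prodMk (hasDerivWithinAt_id t _))
    (fun s hs => ⟨hX_mem t ht, hs⟩)
  have hspace := hd.comp_hasDerivWithinAt (f := fun y => (y, t)) (X t)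
    ((hasDerivWithinAt_id (X t) (Ioo 0 1)).prodMk (hasDerivWithinAt_const (X t) _ t))
    (fun y hy => ⟨hy, ht⟩)
  have h1 : derivWithin (fun s => f (X t) s) (Ico 0 T) t = D (0, 1) :=
    htime.derivWithin (uniqueDiffOn_Ico 0 T t ht)
  have h2 : deriv (fun y => f y t) (X t) = D (1, 0) :=
    (hspace.hasDerivAt (isOpen_Ioo.mem_nhds (hX_mem t ht))).deriv
  rw [h1, h2]
  refine hcurve.congr_deriv ?_
  have : ((v, 1) : ℝ × ℝ) = (0, 1) + v • (1, 0) := by simp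
  rw [this, map_add, map_smul, smul_eq_mul]

/-- A function on `[0,T)` with nonnegative derivative is monotone. -/
theorem monotoneOn_Ico_of_hasDerivWithinAt_nonneg {T : ℝ} {f f' : ℝ → ℝ}
    (hf : ∀ t ∈ Ico 0 T, HasDerivWithinAt f (f' t) (Ico 0 T) t)
    (hf' : ∀ t ∈ Ico 0 T, 0 ≤ f' t) : MonotoneOn f (Ico 0 T) := by
  refine monotoneOn_of_hasDerivWithinAt_nonneg (f' := f') (convex_Ico 0 T)
    (fun t ht => (hf t ht).continuousWithinAt) (fun t ht => ?_)
    (fun t ht => hf' t (interior_subset ht))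
  exact (hf t (interior_subset ht)).mono interior_subset

namespace IsClassicalSolutionSpecial

variable {T : ℝ} {ω ρ Φ : ℝ → ℝ → ℝ}

theorem continuousOn_omega (H : IsClassicalSolutionSpecial T ω ρ Φ) {t : ℝ}
    (ht : t ∈ Ico 0 T) : ContinuousOn (fun y => ω y t) (Ioi 0) := by
  obtain ⟨a, b, ha, hab, hb, hzero⟩ := H.supp t ht.1 ht.2
  intro y hy
  refine ContinuousAt.continuousWithinAt ?_
  rcases lt_or_ge y 1 with hy1 | hy1
  · have h1 : ContinuousOn (fun z => ω z t) (Ioo 0 1) :=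
      H.omega_smooth.continuousOn.comp (f := fun z : ℝ => (z, t)) (by fun_prop)
        fun z hz => ⟨hz, ht⟩
    exact h1.continuousAt (Ioo_mem_nhds hy hy1)
  · have h1 : (fun z => ω z t) =ᶠ[𝓝 y] fun _ => 0 := by
      filter_upwards [Ioi_mem_nhds (hb.trans_le hy1)] with z hz
      exact (hzero z fun hz' => (not_le.2 hz) hz'.2).1
    exact continuousAt_const.congr h1.symm

theorem intervalIntegrable_omega_div (H : IsClassicalSolutionSpecial T ω ρ Φ) {t : ℝ}
    (ht : t ∈ Ico 0 T) {p q : ℝ} (hp : 0 < p) (hq : 0 < q) :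
    IntervalIntegrable (fun y => ω y t / y) volume p q :=
  (((H.continuousOn_omega ht).div continuousOn_id fun _ hx => ne_of_gt hx).mono
    fun _ hx => (lt_min hp hq).trans_le hx.1).intervalIntegrable

theorem integral_omega_div_nonneg (H : IsClassicalSolutionSpecial T ω ρ Φ) (t : ℝ) {p q : ℝ}
    (hp : 0 < p) (hpq : p ≤ q) : 0 ≤ ∫ y in p..q, ω y t / y :=
  intervalIntegral.integral_nonneg hpq fun y hy =>
    div_nonneg (H.omega_nonneg y t) (hp.trans_le hy.1).le

theorem flow_mem (H : IsClassicalSolutionSpecial T ω ρ Φ) {x t : ℝ}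
    (hx : x ∈ Ioo (0 : ℝ) 1) (ht : t ∈ Ico 0 T) : Φ x t ∈ Ioo (0 : ℝ) 1 :=
  (H.flow_bij t ht.1 ht.2).mapsTo hx

theorem hasDerivWithinAt_log_flow (H : IsClassicalSolutionSpecial T ω ρ Φ) {x t : ℝ}
    (hx : x ∈ Ioo (0 : ℝ) 1) (ht : t ∈ Ico 0 T) :
    HasDerivWithinAt (fun s => Real.log (Φ x s)) (-∫ y in Φ x t..1, ω y t / y)
      (Ico 0 T) t := by
  have hpos := (H.flow_mem hx ht).1.ne'
  refine ((H.flow_deriv x hx t ht.1 ht.2).log hpos).congr_deriv ?_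
  rw [svel]
  field_simp

theorem antitoneOn_flow (H : IsClassicalSolutionSpecial T ω ρ Φ) {x : ℝ}
    (hx : x ∈ Ioo (0 : ℝ) 1) : AntitoneOn (Φ x) (Ico 0 T) := by
  have h1 : MonotoneOn (fun s => -Real.log (Φ x s)) (Ico 0 T) :=
    monotoneOn_Ico_of_hasDerivWithinAt_nonneg
      (fun t ht => (H.hasDerivWithinAt_log_flow hx ht).neg) fun t ht => by
        rw [neg_neg]
        exact H.integral_omega_div_nonneg t (H.flow_mem hx ht).1 (H.flow_mem hx ht).2.le
  intro s hs t ht hst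
  have h2 : -Real.log (Φ x s) ≤ -Real.log (Φ x t) := h1 hs ht hst
  exact (Real.log_le_log_iff (H.flow_mem hx ht).1 (H.flow_mem hx hs).1).1 (neg_le_neg_iff.1 h2)

/-- The flow increases logarithmic distances. -/
theorem monotoneOn_log_flow_sub (H : IsClassicalSolutionSpecial T ω ρ Φ) {x z : ℝ}
    (hx : x ∈ Ioo (0 : ℝ) 1) (hz : z ∈ Ioo (0 : ℝ) 1) (hxz : x ≤ z) :
    MonotoneOn (fun s => Real.log (Φ z s) - Real.log (Φ x s)) (Ico 0 T) := by
  refine monotoneOn_Ico_of_hasDerivWithinAt_nonneg (fun t ht =>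
    (H.hasDerivWithinAt_log_flow hz ht).sub (H.hasDerivWithinAt_log_flow hx ht)) fun t ht => ?_
  have hx0 := (H.flow_mem hx ht).1
  have hz0 := (H.flow_mem hz ht).1
  have hle : Φ x t ≤ Φ z t := (H.flow_mono t ht.1 ht.2).monotoneOn hx hz hxz
  have h1 := intervalIntegral.integral_add_adjacent_intervals
    (H.intervalIntegrable_omega_div ht hx0 hz0) (H.intervalIntegrable_omega_div ht hz0 one_pos)
  have h2 := H.integral_omega_div_nonneg t hx0 hle
  linarith

theorem rho_flow (H : IsClassicalSolutionSpecial T ω ρ Φ) {x t : ℝ}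
    (hx : x ∈ Ioo (0 : ℝ) 1) (ht : t ∈ Ico 0 T) : ρ (Φ x t) t = ρ x 0 := by
  have h0 : (0 : ℝ) ∈ Ico 0 T := ⟨le_rfl, H.Tpos⟩
  have hd : ∀ s ∈ Ico 0 T, HasDerivWithinAt (fun s => ρ (Φ x s) s) 0 (Ico 0 T) s :=
    fun s hs => (hasDerivWithinAt_along_curve H.rho_smooth (fun r hr => H.flow_mem hx hr) hs
      (H.flow_deriv x hx s hs.1 hs.2)).congr_deriv
        (H.rho_eq _ (H.flow_mem hx hs) s hs.1 hs.2)
  have h1 := monotoneOn_Ico_of_hasDerivWithinAt_nonneg hd (fun _ _ => le_rfl) h0 ht ht.1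
  have h2 := monotoneOn_Ico_of_hasDerivWithinAt_nonneg (fun s hs => (hd s hs).neg)
    (fun _ _ => neg_zero.ge) h0 ht ht.1
  simp only [Pi.neg_apply, H.flow_init x hx] at h1 h2
  linarith

/-- Growth of the vorticity along a trajectory carrying unit density. -/
theorem omega_flow_add_le (H : IsClassicalSolutionSpecial T ω ρ Φ) {x s t : ℝ}
    (hx : x ∈ Ioo (0 : ℝ) 1) (hρ : ρ x 0 = 1) (hs : s ∈ Ico 0 T) (ht : t ∈ Ico 0 T)
    (hst : s ≤ t) : ω (Φ x s) s + (t - s) / Φ x s ≤ ω (Φ x t) t := by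
  have hd : ∀ r ∈ Ico 0 T,
      HasDerivWithinAt (fun r => ω (Φ x r) r) (1 / Φ x r) (Ico 0 T) r := by
    intro r hr
    refine (hasDerivWithinAt_along_curve H.omega_smooth (fun r hr => H.flow_mem hx hr) hr
      (H.flow_deriv x hx r hr.1 hr.2)).congr_deriv ?_
    rw [H.omega_eq _ (H.flow_mem hx hr) r hr.1 hr.2, H.rho_flow hx hr, hρ]
  have hsub : Icc s t ⊆ Ico 0 T := fun r hr => ⟨hs.1.trans hr.1, hr.2.trans_lt ht.2⟩
  have hmono : MonotoneOn (fun r => ω (Φ x r) r - r * (1 / Φ x s)) (Icc s t) := by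
    refine monotoneOn_of_hasDerivWithinAt_nonneg (f' := fun r => 1 / Φ x r - 1 * (1 / Φ x s))
      (convex_Icc s t)
      (fun r hr => ?_) (fun r hr => ?_) (fun r hr => ?_)
    · exact ((hd r (hsub hr)).continuousWithinAt.mono hsub).sub (by fun_prop)
    · exact ((hd r (hsub (interior_subset hr))).mono (interior_subset.trans hsub)).sub
        ((hasDerivWithinAt_id r _).mul_const _)
    · have hr := interior_subset hr
      rw [one_mul, sub_nonneg]
      exact one_div_le_one_div_of_le (H.flow_mem hx (hsub hr)).1
        (H.antitoneOn_flow hx hs (hsub hr) hr.1)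
  have h1 := hmono (left_mem_Icc.2 hst) (right_mem_Icc.2 hst) hst
  have h2 : (t - s) / Φ x s = t * (1 / Φ x s) - s * (1 / Φ x s) := by ring
  simp only at h1
  linarith

/-- Growth of the vorticity integral between two trajectories bounding a region of unit
density. -/
theorem integral_omega_div_add_le (H : IsClassicalSolutionSpecial T ω ρ Φ) {p q s t : ℝ}
    (hp : p ∈ Ioo (0 : ℝ) 1) (hq : q ∈ Ioo (0 : ℝ) 1) (hpq : p ≤ q)
    (hρ : ∀ x ∈ Icc p q, ρ x 0 = 1) (hs : s ∈ Ico 0 T) (ht : t ∈ Ico 0 T) (hst : s ≤ t) :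
    (∫ y in Φ p s..Φ q s, ω y s / y) + (t - s) * (1 / Φ p s - 1 / Φ q s)
      ≤ ∫ y in Φ p t..Φ q t, ω y t / y := by
  have hsubI : Icc p q ⊆ Ioo (0 : ℝ) 1 := fun x hx => ⟨hp.1.trans_le hx.1, hx.2.trans_lt hq.2⟩
  have hmono := H.flow_mono t ht.1 ht.2
  have hbij := H.flow_bij t ht.1 ht.2
  set ζ := Function.invFunOn (fun x => Φ x t) (Ioo 0 1)
  have hζ_left : ∀ x ∈ Ioo (0 : ℝ) 1, ζ (Φ x t) = x := fun x hx =>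
    hbij.injOn.leftInvOn_invFunOn hx
  have hpt := H.flow_mem hp ht
  have hps := H.flow_mem hp hs
  have hqs := H.flow_mem hq hs
  have hle : Φ p t ≤ Φ q t := hmono.monotoneOn hp hq hpq
  have hex : ∀ y ∈ Icc (Φ p t) (Φ q t), ∃ x ∈ Icc p q, Φ x t = y := by
    intro y hy
    obtain ⟨x, hx, rfl⟩ := hbij.surjOn
      ⟨hpt.1.trans_le hy.1, hy.2.trans_lt (H.flow_mem hq ht).2⟩
    exact ⟨x, ⟨(hmono.le_iff_le hp hx).1 hy.1, (hmono.le_iff_le hx hq).1 hy.2⟩, rfl⟩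
  have key := integral_div_le_of_log_nonexpansive (η := fun y => Φ (ζ y) s)
    (h := fun y => ω y s + (t - s) * |1 / y|) (g := fun y => ω y t) hpt.1 hle
    ?_ ?_ ?_ ?_ ?_ (H.continuousOn_omega ht) ?_
  · simp only [hζ_left p hp, hζ_left q hq] at key
    refine le_trans (le_of_eq ?_) key
    have hles : Φ p s ≤ Φ q s := (H.flow_mono s hs.1 hs.2).monotoneOn hp hq hpq
    have hne : ∀ y ∈ uIcc (Φ p s) (Φ q s), y ≠ 0 := fun y hy =>
      ((lt_min hps.1 hqs.1).trans_le hy.1).ne'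
    have hderiv : ∀ y ∈ uIcc (Φ p s) (Φ q s),
        HasDerivAt (fun y => -(1 / y)) (1 / y ^ 2) y := by
      intro y hy
      simpa using (hasDerivAt_inv (hne y hy)).fun_neg
    have hcont : ContinuousOn (fun y : ℝ => 1 / y ^ 2) (uIcc (Φ p s) (Φ q s)) :=
      continuousOn_const.div (by fun_prop) fun y hy => pow_ne_zero 2 (hne y hy)
    have hint := intervalIntegral.integral_eq_sub_of_hasDerivAt hderiv
      hcont.intervalIntegrable
    have hfun : ∫ y in Φ p s..Φ q s, (ω y s + (t - s) * |1 / y|) / y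
        = ∫ y in Φ p s..Φ q s, (ω y s / y + (t - s) * (1 / y ^ 2)) := by
      refine intervalIntegral.integral_congr fun y hy => ?_
      have hy0 : 0 < y := (lt_min hps.1 hqs.1).trans_le hy.1
      simp only [abs_of_pos (one_div_pos.2 hy0)]
      field_simp
    rw [hfun, intervalIntegral.integral_add (H.intervalIntegrable_omega_div hs hps.1 hqs.1)
      (hcont.intervalIntegrable.const_mul _), intervalIntegral.integral_const_mul, hint]
    ring
  · intro y hy
    obtain ⟨x, hx, rfl⟩ := hex y hy
    simpa only [hζ_left x (hsubI hx)] using (H.flow_mem (hsubI hx) hs).1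
  · intro y hy z hz hyz
    obtain ⟨x, hx, rfl⟩ := hex y hy
    obtain ⟨w, hw, rfl⟩ := hex z hz
    simp only [hζ_left x (hsubI hx), hζ_left w (hsubI hw)]
    exact (H.flow_mono s hs.1 hs.2).monotoneOn (hsubI hx) (hsubI hw)
      ((hmono.le_iff_le (hsubI hx) (hsubI hw)).1 hyz)
  · intro y hy z hz hyz
    obtain ⟨x, hx, rfl⟩ := hex y hy
    obtain ⟨w, hw, rfl⟩ := hex z hz
    simp only [hζ_left x (hsubI hx), hζ_left w (hsubI hw)]
    exact H.monotoneOn_log_flow_sub (hsubI hx) (hsubI hw)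
      ((hmono.le_iff_le (hsubI hx) (hsubI hw)).1 hyz) hs ht hst
  · exact (H.continuousOn_omega hs).add (continuousOn_const.mul
      (continuousOn_const.div continuousOn_id fun _ hx => ne_of_gt hx).abs)
  · exact fun y => add_nonneg (H.omega_nonneg y s) (mul_nonneg (sub_nonneg.2 hst) (abs_nonneg _))
  · intro y hy
    obtain ⟨x, hx, rfl⟩ := hex y hy
    have hx0 := (H.flow_mem (hsubI hx) hs).1
    simp only [hζ_left x (hsubI hx), abs_of_pos (one_div_pos.2 hx0), mul_one_div]
    exact H.omega_flow_add_le (hsubI hx) (hρ x hx) hs ht hst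

/-- Over two consecutive time steps of length `δ`, the trajectory from `1/3` gains
logarithmically at least `δ² / (2 Φ)`. -/
theorem log_flow_step (H : IsClassicalSolutionSpecial T ω ρ Φ)
    (hρ : ∀ x ∈ Icc (1/3 : ℝ) (2/3), ρ x 0 = 1) {t δ : ℝ} (ht : 0 ≤ t) (hδ : 0 ≤ δ)
    (htT : t + 2 * δ < T) :
    Real.log (Φ (1/3) (t + 2 * δ)) + δ ^ 2 / (2 * Φ (1/3) t) ≤ Real.log (Φ (1/3) t) := by
  have hp : (1/3 : ℝ) ∈ Ioo (0 : ℝ) 1 := by norm_num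
  have hq : (2/3 : ℝ) ∈ Ioo (0 : ℝ) 1 := by norm_num
  have hpq : (1/3 : ℝ) ≤ 2/3 := by norm_num
  have h0 : (0 : ℝ) ∈ Ico 0 T := ⟨le_rfl, H.Tpos⟩
  have ht0 : t ∈ Ico 0 T := ⟨ht, by linarith⟩
  have ht1 : t + δ ∈ Ico 0 T := ⟨by linarith, by linarith⟩
  have ht2 : t + 2 * δ ∈ Ico 0 T := ⟨by linarith, htT⟩
  have hA := (H.flow_mem hp ht0).1
  have hB := (H.flow_mem hq ht0).1
  have hratio : 2 * Φ (1/3) t ≤ Φ (2/3) t := by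
    have h1 := H.monotoneOn_log_flow_sub hp hq hpq h0 ht0 ht
    simp only [H.flow_init _ hp, H.flow_init _ hq] at h1
    rw [← Real.log_div (by norm_num) (by norm_num), ← Real.log_div hB.ne' hA.ne',
      Real.log_le_log_iff (by norm_num) (div_pos hB hA), le_div_iff₀ hA] at h1
    linarith
  have hgap : 1 / (2 * Φ (1/3) t) ≤ 1 / Φ (1/3) t - 1 / Φ (2/3) t := by
    have h1 : 1 / Φ (2/3) t ≤ 1 / (2 * Φ (1/3) t) :=
      one_div_le_one_div_of_le (by positivity) hratio
    have h2 : 1 / Φ (1/3) t = 1 / (2 * Φ (1/3) t) + 1 / (2 * Φ (1/3) t) := by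
      field_simp
      norm_num
    linarith
  have hJ : ∀ r ∈ Ico 0 T, t + δ ≤ r →
      δ / (2 * Φ (1/3) t) ≤ ∫ y in Φ (1/3) r..1, ω y r / y := by
    intro r hr htr
    have hAr := (H.flow_mem hp hr).1
    have hBr := H.flow_mem hq hr
    have h1 := H.integral_omega_div_add_le hp hq hpq hρ ht0 hr (by linarith)
    have h2 := H.integral_omega_div_nonneg t hA ((H.flow_mono t ht0.1 ht0.2).monotoneOn hp hq hpq)
    have h3 := intervalIntegral.integral_add_adjacent_intervals
      (H.intervalIntegrable_omega_div hr hAr hBr.1)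
      (H.intervalIntegrable_omega_div hr hBr.1 one_pos)
    have h4 := H.integral_omega_div_nonneg r hBr.1 hBr.2.le
    have h5 : δ / (2 * Φ (1/3) t) ≤ (r - t) * (1 / Φ (1/3) t - 1 / Φ (2/3) t) := by
      rw [← mul_one_div]
      exact mul_le_mul (by linarith) hgap (by positivity) (by linarith)
    linarith
  set m := δ / (2 * Φ (1/3) t) with hm
  have hsub : Icc (t + δ) (t + 2 * δ) ⊆ Ico 0 T := fun r hr =>
    ⟨ht1.1.trans hr.1, hr.2.trans_lt htT⟩
  have hmono : MonotoneOn (fun r => -Real.log (Φ (1/3) r) - r * m)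
      (Icc (t + δ) (t + 2 * δ)) := by
    refine monotoneOn_of_hasDerivWithinAt_nonneg
      (f' := fun r => -(-∫ y in Φ (1/3) r..1, ω y r / y) - 1 * m) (convex_Icc _ _)
      (fun r hr => ?_) (fun r hr => ?_) (fun r hr => ?_)
    · exact ((H.hasDerivWithinAt_log_flow hp (hsub hr)).continuousWithinAt.mono hsub).neg.sub
        (by fun_prop)
    · exact ((H.hasDerivWithinAt_log_flow hp (hsub (interior_subset hr))).mono
        (interior_subset.trans hsub)).neg.sub ((hasDerivWithinAt_id r _).mul_const _)
    · have hr := interior_subset hr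
      have := hJ r (hsub hr) hr.1
      linarith
  have hstep : t + δ ≤ t + 2 * δ := by linarith
  have h1 := hmono (left_mem_Icc.2 hstep) (right_mem_Icc.2 hstep) hstep
  have h2 := Real.log_le_log (H.flow_mem hp ht1).1
    (H.antitoneOn_flow hp ht0 ht1 (by linarith))
  have h3 : δ ^ 2 / (2 * Φ (1/3) t) = (t + 2 * δ) * m - (t + δ) * m := by
    rw [hm]
    ring
  simp only at h1
  linarith

theorem four_pow_mul_flow_le_one (H : IsClassicalSolutionSpecial T ω ρ Φ)
    (hρ : ∀ x ∈ Icc (1/3 : ℝ) (2/3), ρ x 0 = 1) (hT : 8 < T) (n : ℕ) :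
    4 ^ n * Φ (1/3) (8 * (1 - (1/2) ^ n)) ≤ 1 := by
  have hp : (1/3 : ℝ) ∈ Ioo (0 : ℝ) 1 := by norm_num
  induction n with
  | zero => norm_num [H.flow_init _ hp]
  | succ n ih =>
    set ε : ℝ := (1/2) ^ n with hε
    have hε0 : 0 < ε := by positivity
    have hε1 : ε ≤ 1 := pow_le_one₀ (by norm_num) (by norm_num)
    have hεn : ε ^ 2 * 4 ^ n = 1 := by
      rw [hε, ← pow_mul, mul_comm n 2, pow_mul, ← mul_pow]
      norm_num
    have htime : 8 * (1 - (1/2 : ℝ) ^ (n + 1)) = 8 * (1 - ε) + 2 * (2 * ε) := by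
      rw [pow_succ]
      ring
    have hstep := H.log_flow_step hρ (t := 8 * (1 - ε)) (δ := 2 * ε) (by linarith)
      (by linarith) (by linarith)
    rw [htime]
    set A := Φ (1/3) (8 * (1 - ε))
    set A' := Φ (1/3) (8 * (1 - ε) + 2 * (2 * ε))
    have hA : 0 < A := (H.flow_mem hp ⟨by linarith, by linarith⟩).1
    have hA' : 0 < A' := (H.flow_mem hp ⟨by linarith, by linarith⟩).1
    have hgain : 2 ≤ (2 * ε) ^ 2 / (2 * A) := by
      rw [le_div_iff₀ (by positivity)]
      have : A ≤ ε ^ 2 := by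
        calc A = ε ^ 2 * (4 ^ n * A) := by rw [← mul_assoc, hεn, one_mul]
          _ ≤ ε ^ 2 * 1 := by gcongr
          _ = ε ^ 2 := mul_one _
      linarith
    have hexp : (4 : ℝ) ≤ Real.exp 2 := by
      have h1 := Real.add_one_le_exp (1 : ℝ)
      have h2 : Real.exp 2 = Real.exp 1 * Real.exp 1 := by
        rw [← Real.exp_add]
        norm_num
      nlinarith
    have hAA' : A' * Real.exp 2 ≤ A := by
      have h1 : Real.log A' + 2 ≤ Real.log A := by linarith
      have h2 := Real.exp_le_exp.2 h1
      rwa [Real.exp_add, Real.exp_log hA, Real.exp_log hA'] at h2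
    calc 4 ^ (n + 1) * A' = 4 ^ n * (A' * 4) := by ring
      _ ≤ 4 ^ n * (A' * Real.exp 2) := by gcongr
      _ ≤ 4 ^ n * A := by gcongr
      _ ≤ 1 := ih

theorem lifespan_le (H : IsClassicalSolutionSpecial T ω ρ Φ)
    (hρ : ∀ x ∈ Icc (1/3 : ℝ) (2/3), ρ x 0 = 1) : T ≤ 8 := by
  by_contra! hT
  have hp : (1/3 : ℝ) ∈ Ioo (0 : ℝ) 1 := by norm_num
  have h8 : (8 : ℝ) ∈ Ico 0 T := ⟨by norm_num, hT⟩
  have hA := (H.flow_mem hp h8).1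
  obtain ⟨n, hn⟩ := pow_unbounded_of_one_lt (1 / Φ (1/3) 8) (by norm_num : (1 : ℝ) < 4)
  rw [div_lt_iff₀ hA] at hn
  have hε0 : (0 : ℝ) < (1/2) ^ n := by positivity
  have hε1 : ((1 : ℝ)/2) ^ n ≤ 1 := pow_le_one₀ (by norm_num) (by norm_num)
  have h1 : Φ (1/3) 8 ≤ Φ (1/3) (8 * (1 - (1/2) ^ n)) :=
    H.antitoneOn_flow hp ⟨by linarith, by linarith⟩ h8 (by linarith)
  have h2 : (4 : ℝ) ^ n * Φ (1/3) 8 ≤ 4 ^ n * Φ (1/3) (8 * (1 - (1/2) ^ n)) := by gcongr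
  linarith [H.four_pow_mul_flow_le_one hρ hT n]

end IsClassicalSolutionSpecial

/-- **Finite time blow up for the sign-definite special case.** There are nonnegative
smooth data compactly supported in `(0,1)` (with `ω₀ = 0`, `0 ≤ ρ₀ ≤ 1`, `ρ₀ ≡ 1` on
`[1/3,2/3]`) and a finite time `T* > 0` such that no classical solution of the special
model with this data exists on all of `[0,T*]`. -/
theorem finite_time_blowup_special :
    ∃ ω₀ ρ₀ : ℝ → ℝ, ∃ Tstar : ℝ, 0 < Tstar ∧
      ω₀ = 0 ∧
      ContDiffOn ℝ (⊤ : ℕ∞) ρ₀ (Set.Ioo 0 1) ∧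
      (∀ x, 0 ≤ ρ₀ x ∧ ρ₀ x ≤ 1) ∧
      (∀ x ∈ Set.Icc (1/3 : ℝ) (2/3 : ℝ), ρ₀ x = 1) ∧
      (∃ a b : ℝ, 0 < a ∧ a ≤ b ∧ b < 1 ∧
        ∀ x, x ∉ Set.Icc a b → ω₀ x = 0 ∧ ρ₀ x = 0) ∧
      ∀ T : ℝ, ∀ ω ρ Φ : ℝ → ℝ → ℝ,
        IsClassicalSolutionSpecial T ω ρ Φ →
        (∀ x ∈ Set.Ioo (0:ℝ) 1, ω x 0 = ω₀ x ∧ ρ x 0 = ρ₀ x) →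
        T ≤ Tstar := by
  let χ : ContDiffBump (1/2 : ℝ) := ⟨1/6, 1/4, by norm_num, by norm_num⟩
  have hone : ∀ x ∈ Icc (1/3 : ℝ) (2/3), χ x = 1 := fun x hx =>
    χ.one_of_mem_closedBall (by
      rw [Real.closedBall_eq_Icc]
      constructor <;> norm_num [χ] <;> linarith [hx.1, hx.2])
  refine ⟨0, χ, 8, by norm_num, rfl, χ.contDiff.contDiffOn, fun x => ⟨χ.nonneg, χ.le_one⟩, hone,
    ⟨1/4, 3/4, by norm_num, by norm_num, by norm_num, fun x hx => ⟨rfl, ?_⟩⟩, ?_⟩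
  · refine χ.zero_of_le_dist ?_
    by_contra! h
    rw [Real.dist_eq, abs_lt] at h
    norm_num [χ] at h
    exact hx ⟨by linarith, by linarith⟩
  · intro T ω ρ Φ H h0
    refine H.lifespan_le fun x hx => ?_
    rw [(h0 x ⟨by linarith [hx.1], by linarith [hx.2]⟩).2, hone x hx]
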